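/- Let n ≥ 1 and T > 0. Let f : [0,T] × ℝⁿ → ℝ be smooth, positive, and ℤⁿ-periodic in the space variable, satisfying the nonlinear heat equation ∂_t f = Δf − f·log f on [0,T] × ℝⁿ. Then for every t ∈ (0,T] and every x ∈ ℝⁿ: 2·Δ(log f)(t,x) + |∇(log f)(t,x)|² + 2n/t + n/4 ≥ 0. -/

import Mathlib

open Set
open scoped RealInnerProductSpace

noncomputable section

/-- The `i`-th standard basis vector of `ℝⁿ`. -/
def e (n : ℕ) (i : Fin n) : EuclideanSpace ℝ (Fin n) := EuclideanSpace.single i 1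

/-- Spatial gradient of a time-dependent function on `ℝⁿ`. -/
def sgrad (n : ℕ) (u : ℝ → EuclideanSpace ℝ (Fin n) → ℝ) (t : ℝ)
    (x : EuclideanSpace ℝ (Fin n)) : EuclideanSpace ℝ (Fin n) :=
  gradient (u t) x

/-- `(i,j)` entry of the spatial Hessian of a time-dependent function on `ℝⁿ`. -/
def shess (n : ℕ) (u : ℝ → EuclideanSpace ℝ (Fin n) → ℝ) (t : ℝ)
    (x : EuclideanSpace ℝ (Fin n)) (i j : Fin n) : ℝ :=
  fderiv ℝ (fun y => fderiv ℝ (u t) y (e n j)) x (e n i)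

/-- Spatial Laplacian (trace of the spatial Hessian). -/
def slap (n : ℕ) (u : ℝ → EuclideanSpace ℝ (Fin n) → ℝ) (t : ℝ)
    (x : EuclideanSpace ℝ (Fin n)) : ℝ :=
  ∑ i, shess n u t x i i

/-- Squared Frobenius norm of the spatial Hessian. -/
def hessSq (n : ℕ) (u : ℝ → EuclideanSpace ℝ (Fin n) → ℝ) (t : ℝ)
    (x : EuclideanSpace ℝ (Fin n)) : ℝ :=
  ∑ i, ∑ j, (shess n u t x i j) ^ 2

/-- Time derivative of a time-dependent function on `ℝⁿ`. -/
def tderiv (n : ℕ) (u : ℝ → EuclideanSpace ℝ (Fin n) → ℝ) (t : ℝ)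
    (x : EuclideanSpace ℝ (Fin n)) : ℝ :=
  deriv (fun s => u s x) t


section calculus
variable {W : Type*} [NormedAddCommGroup W] [NormedSpace ℝ W]

/-- directional derivative -/
def DD (v : W) (F : W → ℝ) (z : W) : ℝ := fderiv ℝ F z v

lemma DD_smooth {U : Set W} (hU : IsOpen U) {F : W → ℝ}
    (hF : ContDiffOn ℝ (⊤ : ℕ∞) F U) (v : W) : ContDiffOn ℝ (⊤ : ℕ∞) (DD v F) U := by
  have h := hF.fderiv_of_isOpen hU (m := (⊤ : ℕ∞)) (by simp)
  exact h.clm_apply contDiffOn_const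

lemma smooth_diffAt {U : Set W} (hU : IsOpen U) {F : W → ℝ}
    (hF : ContDiffOn ℝ (⊤ : ℕ∞) F U) {z : W} (hz : z ∈ U) : DifferentiableAt ℝ F z :=
  (hF.contDiffAt (hU.mem_nhds hz)).differentiableAt (by simp)

lemma DD_comm {U : Set W} (hU : IsOpen U) {F : W → ℝ}
    (hF : ContDiffOn ℝ (⊤ : ℕ∞) F U) (v w : W) {z : W} (hz : z ∈ U) :
    DD v (DD w F) z = DD w (DD v F) z := by
  have h2 : DifferentiableAt ℝ (fderiv ℝ F) z :=
    ((hF.fderiv_of_isOpen hU (m := (⊤ : ℕ∞)) (by simp)).contDiffAt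
      (hU.mem_nhds hz)).differentiableAt (by simp)
  have key : ∀ a b : W, DD a (DD b F) z = fderiv ℝ (fderiv ℝ F) z a b := by
    intro a b
    have := h2.hasFDerivAt.clm_apply (hasFDerivAt_const b z)
    unfold DD
    rw [this.fderiv]
    simp
  rw [key, key]
  have hs : IsSymmSndFDerivAt ℝ F z :=
    (hF.contDiffAt (hU.mem_nhds hz)).isSymmSndFDerivAt (by simpa using WithTop.coe_le_coe.2 (le_top : (2 : ℕ∞) ≤ ⊤))
  exact hs v w

lemma DD_congr {U : Set W} (hU : IsOpen U) {F G : W → ℝ} (h : ∀ z ∈ U, F z = G z)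
    (v : W) {z : W} (hz : z ∈ U) : DD v F z = DD v G z := by
  have : F =ᶠ[nhds z] G := by
    filter_upwards [hU.mem_nhds hz] with y hy using h y hy
  unfold DD
  rw [this.fderiv_eq]

lemma DD_shape {n : ℕ} {U : Set W} (hU : IsOpen U) {A B : Fin n → W → ℝ} {C : W → ℝ}
    (hA : ∀ i, ContDiffOn ℝ (⊤ : ℕ∞) (A i) U) (hB : ∀ i, ContDiffOn ℝ (⊤ : ℕ∞) (B i) U)
    (hC : ContDiffOn ℝ (⊤ : ℕ∞) C U) (a b : ℝ) (v : W) {z : W} (hz : z ∈ U) :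
    DD v (fun z => a * ∑ i, A i z + ∑ i, (B i z) ^ 2 + b * C z) z
      = a * ∑ i, DD v (A i) z + ∑ i, 2 * (B i z * DD v (B i) z) + b * DD v C z := by
  have h1 : HasFDerivAt (fun z => ∑ i, A i z) (∑ i, fderiv ℝ (A i) z) z :=
    HasFDerivAt.fun_sum fun i _ => (smooth_diffAt hU (hA i) hz).hasFDerivAt
  have h2 := HasFDerivAt.fun_sum (u := Finset.univ) fun i _ =>
    ((smooth_diffAt hU (hB i) hz).hasFDerivAt).pow 2
  have h3 := (smooth_diffAt hU hC hz).hasFDerivAt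
  have := ((h1.const_mul a).add h2).add (h3.const_mul b)
  unfold DD
  refine (congrArg (fun L => L v) this.fderiv).trans ?_
  simp [mul_assoc]

lemma DD_shape2 {n : ℕ} {U : Set W} (hU : IsOpen U) {A B B' : Fin n → W → ℝ} {C : W → ℝ}
    (hA : ∀ i, ContDiffOn ℝ (⊤ : ℕ∞) (A i) U) (hB : ∀ i, ContDiffOn ℝ (⊤ : ℕ∞) (B i) U)
    (hB' : ∀ i, ContDiffOn ℝ (⊤ : ℕ∞) (B' i) U)
    (hC : ContDiffOn ℝ (⊤ : ℕ∞) C U) (a b : ℝ) (v : W) {z : W} (hz : z ∈ U) :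
    DD v (fun z => a * ∑ i, A i z + ∑ i, 2 * (B i z * B' i z) + b * C z) z
      = a * ∑ i, DD v (A i) z + ∑ i, 2 * (DD v (B i) z * B' i z + B i z * DD v (B' i) z)
        + b * DD v C z := by
  have h1 : HasFDerivAt (fun z => ∑ i, A i z) (∑ i, fderiv ℝ (A i) z) z :=
    HasFDerivAt.fun_sum fun i _ => (smooth_diffAt hU (hA i) hz).hasFDerivAt
  have h2 := HasFDerivAt.fun_sum (u := Finset.univ) fun i _ =>
    (((smooth_diffAt hU (hB i) hz).hasFDerivAt).mul
      ((smooth_diffAt hU (hB' i) hz).hasFDerivAt)).const_mul 2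
  have h3 := (smooth_diffAt hU hC hz).hasFDerivAt
  have := ((h1.const_mul a).add h2).add (h3.const_mul b)
  unfold DD
  refine (congrArg (fun L => L v) this.fderiv).trans ?_
  simp
  refine Finset.sum_congr rfl fun i _ => ?_
  ring

/-- The Harnack quantity. -/
def PP {n : ℕ} (e : Fin n → W) (u : W → ℝ) (z : W) : ℝ :=
  2 * ∑ i, DD (e i) (DD (e i) u) z + ∑ i, (DD (e i) u z) ^ 2

lemma PP_smooth {n : ℕ} {U : Set W} (hU : IsOpen U) (e : Fin n → W) {u : W → ℝ}
    (hu : ContDiffOn ℝ (⊤ : ℕ∞) u U) : ContDiffOn ℝ (⊤ : ℕ∞) (PP e u) U := by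
  unfold PP
  exact (contDiffOn_const.mul (ContDiffOn.sum fun i _ => DD_smooth hU (DD_smooth hU hu _) _)).add
    (ContDiffOn.sum fun i _ => (DD_smooth hU hu _).pow 2)

lemma alg_aux {n : ℕ} (a d Q H S T G : Fin n → ℝ) (h : ∑ i, S i = ∑ i, a i * T i) :
    2 * ∑ i, (1 * Q i + 2 * (H i + S i) + (-1) * d i)
      + 2 * ∑ i, (a i * (1 * T i + 2 * G i + (-1) * a i)) =
    ∑ i, (2 * Q i + 2 * (H i + S i) + 0 * d i) + 2 * ∑ i, a i * (2 * T i + 2 * G i + 0 * a i)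
      + 2 * ∑ i, H i - 2 * ∑ i, d i - 2 * ∑ i, (a i) ^ 2 := by
  rw [← sub_eq_zero] at h ⊢
  simp only [Finset.mul_sum, ← Finset.sum_add_distrib, ← Finset.sum_sub_distrib] at h ⊢
  have : ∀ c : ℝ, c * ∑ i, (S i - a i * T i) = 0 := fun c => by rw [h]; simp
  refine Eq.trans ?_ (this 2)
  rw [Finset.mul_sum]
  exact Finset.sum_congr rfl fun i _ => by ring

lemma evolution {n : ℕ} {U : Set W} (hU : IsOpen U) (e : Fin n → W) (τ : W) {u : W → ℝ}
    (hu : ContDiffOn ℝ (⊤ : ℕ∞) u U)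
    (hpde : ∀ z ∈ U, DD τ u z
      = ∑ i, DD (e i) (DD (e i) u) z + ∑ i, (DD (e i) u z) ^ 2 - u z)
    {z : W} (hz : z ∈ U) :
    DD τ (PP e u) z = ∑ i, DD (e i) (DD (e i) (PP e u)) z
      + 2 * ∑ i, DD (e i) u z * DD (e i) (PP e u) z
      + 2 * ∑ i, ∑ j, (DD (e i) (DD (e j) u) z) ^ 2
      - 2 * ∑ i, DD (e i) (DD (e i) u) z - 2 * ∑ i, (DD (e i) u z) ^ 2 := by
  have s1 : ∀ v, ContDiffOn ℝ (⊤ : ℕ∞) (DD v u) U := fun v => DD_smooth hU hu v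
  have s2 : ∀ v w, ContDiffOn ℝ (⊤ : ℕ∞) (DD v (DD w u)) U := fun v w => DD_smooth hU (s1 w) v
  have s3 : ∀ v w x, ContDiffOn ℝ (⊤ : ℕ∞) (DD v (DD w (DD x u))) U :=
    fun v w x => DD_smooth hU (s2 w x) v
  have hP : PP e u = fun z => 2 * ∑ i, DD (e i) (DD (e i) u) z + ∑ i, (DD (e i) u z) ^ 2
      + 0 * u z := by
    funext z; simp [PP]
  have d1 : ∀ v, ∀ z ∈ U, DD v (PP e u) z = 2 * ∑ j, DD v (DD (e j) (DD (e j) u)) z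
      + ∑ j, 2 * (DD (e j) u z * DD v (DD (e j) u) z) + 0 * DD v u z := by
    intro v z hz
    rw [hP]
    exact DD_shape hU (fun i => s2 _ _) (fun i => s1 _) hu 2 0 v hz
  have d2 : ∀ v, ∀ z ∈ U, DD v (DD v (PP e u)) z
      = 2 * ∑ j, DD v (DD v (DD (e j) (DD (e j) u))) z
      + ∑ j, 2 * (DD v (DD (e j) u) z * DD v (DD (e j) u) z
        + DD (e j) u z * DD v (DD v (DD (e j) u)) z) + 0 * DD v (DD v u) z := by
    intro v z hz
    rw [DD_congr hU (d1 v) v hz]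
    exact DD_shape2 hU (fun i => s3 _ _ _) (fun i => s1 _) (fun i => s2 _ _) (s1 _) 2 0 v hz
  have hpde' : ∀ z ∈ U, DD τ u z
      = 1 * ∑ i, DD (e i) (DD (e i) u) z + ∑ i, (DD (e i) u z) ^ 2 + (-1) * u z := by
    intro z hz; rw [hpde z hz]; ring
  have q1 : ∀ v, ∀ z ∈ U, DD τ (DD v u) z = 1 * ∑ j, DD v (DD (e j) (DD (e j) u)) z
      + ∑ j, 2 * (DD (e j) u z * DD v (DD (e j) u) z) + (-1) * DD v u z := by
    intro v z hz
    rw [DD_comm hU hu _ _ hz, DD_congr hU hpde' v hz]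
    exact DD_shape hU (fun i => s2 _ _) (fun i => s1 _) hu _ _ v hz
  have q2 : ∀ v, ∀ z ∈ U, DD τ (DD v (DD v u)) z
      = 1 * ∑ j, DD v (DD v (DD (e j) (DD (e j) u))) z
      + ∑ j, 2 * (DD v (DD (e j) u) z * DD v (DD (e j) u) z
        + DD (e j) u z * DD v (DD v (DD (e j) u)) z) + (-1) * DD v (DD v u) z := by
    intro v z hz
    rw [DD_comm hU (s1 v) _ _ hz, DD_congr hU (q1 v) v hz]
    exact DD_shape2 hU (fun i => s3 _ _ _) (fun i => s1 _) (fun i => s2 _ _) (s1 _) _ _ v hz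
  have c3 : ∀ i j, DD (e i) (DD (e i) (DD (e j) u)) z = DD (e j) (DD (e i) (DD (e i) u)) z := by
    intro i j
    rw [DD_congr hU (fun z hz => DD_comm hU hu (e i) (e j) hz) (e i) hz,
      DD_comm hU (s1 _) _ _ hz]
  rw [d1 τ z hz]
  simp only [q1 _ z hz, q2 _ z hz, d1 _ z hz, d2 _ z hz]
  have sw : ∑ i, ∑ j, DD (e j) u z * DD (e i) (DD (e i) (DD (e j) u)) z
      = ∑ i, ∑ j, DD (e i) u z * DD (e i) (DD (e j) (DD (e j) u)) z := by
    rw [Finset.sum_comm]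
    refine Finset.sum_congr rfl fun i _ => Finset.sum_congr rfl fun j _ => ?_
    rw [c3]
  have sw' : ∑ i, ∑ j, DD (e j) u z * DD (e i) (DD (e i) (DD (e j) u)) z
      = ∑ i, DD (e i) u z * ∑ j, DD (e i) (DD (e j) (DD (e j) u)) z := by
    rw [sw]; simp only [Finset.mul_sum]
  have alg := alg_aux (fun i => DD (e i) u z) (fun i => DD (e i) (DD (e i) u) z)
    (fun i => ∑ j, DD (e i) (DD (e i) (DD (e j) (DD (e j) u))) z)
    (fun i => ∑ j, (DD (e i) (DD (e j) u) z) ^ 2)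
    (fun i => ∑ j, DD (e j) u z * DD (e i) (DD (e i) (DD (e j) u)) z)
    (fun i => ∑ j, DD (e i) (DD (e j) (DD (e j) u)) z)
    (fun i => ∑ j, DD (e j) u z * DD (e i) (DD (e j) u) z) sw'
  simp only [← Finset.mul_sum, Finset.sum_add_distrib, ← pow_two] at alg ⊢
  linarith

end calculus

lemma snd_deriv_test {g g' : ℝ → ℝ} {d : ℝ} (h1 : ∀ s, HasDerivAt g (g' s) s)
    (h2 : HasDerivAt g' d 0) (hmin : ∀ s, g 0 ≤ g s) : g' 0 = 0 ∧ 0 ≤ d := by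
  have h0 : g' 0 = 0 :=
    IsLocalMin.hasDerivAt_eq_zero (Filter.Eventually.of_forall hmin) (h1 0)
  refine ⟨h0, ?_⟩
  by_contra! hd
  have k1 : ∀ s, HasDerivAt (fun s => - g s + (d / 4) * s ^ 2) (- g' s + (d / 2) * s) s := by
    intro s
    have := (h1 s).neg.add (((hasDerivAt_id s).pow 2).const_mul (d / 4))
    refine this.congr_deriv ?_
    simp; ring
  have k2 : HasDerivAt (fun s => - g' s + (d / 2) * s) (- d / 2) 0 := by
    have := h2.neg.add ((hasDerivAt_id (0 : ℝ)).const_mul (d / 2))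
    refine this.congr_deriv ?_
    ring
  have hder : deriv (fun s => - g s + (d / 4) * s ^ 2) = fun s => - g' s + (d / 2) * s := by
    funext s; exact (k1 s).deriv
  have hm := isLocalMin_of_deriv_deriv_pos (f := fun s => - g s + (d / 4) * s ^ 2) (x₀ := 0)
    (by rw [hder, k2.deriv]; linarith) (by rw [hder]; simp [h0]) (k1 0).continuousAt
  obtain ⟨r, hr, hball⟩ := Metric.eventually_nhds_iff.1 hm
  have := hball (y := r / 2) (by simp [abs_of_pos hr]; exact hr)
  have h3 := hmin (r / 2)
  simp at this
  nlinarith [sq_nonneg r, mul_pos hr hr, mul_pos (mul_pos hr hr) (neg_pos.2 hd)]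

lemma left_deriv_nonpos {g : ℝ → ℝ} {d t a : ℝ} (hat : a < t) (h : HasDerivAt g d t)
    (hmin : ∀ s, a ≤ s → s ≤ t → g t ≤ g s) : d ≤ 0 := by
  have h1 := (hasDerivAt_iff_tendsto_slope_left_right.1 h).1
  refine le_of_tendsto h1 ?_
  filter_upwards [Ioo_mem_nhdsLT hat] with s hs
  rw [slope_def_field]
  exact div_nonpos_of_nonneg_of_nonpos (sub_nonneg.2 (hmin s hs.1.le hs.2.le))
    (by linarith [hs.2])

lemma final_alg {N t w q : ℝ} (hN : 0 < N) (ht : 0 < t) (hq : 0 ≤ q)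
    (hneg : 2 * w + q + 2 * N / t + N / 4 < 0) :
    0 < 2 * (w ^ 2 / N) - 2 * w - 2 * q - 2 * N / t ^ 2 := by
  obtain ⟨r, hr⟩ : ∃ r, r = 1 / t := ⟨_, rfl⟩
  have hr0 : 0 < r := by rw [hr]; positivity
  obtain ⟨y, hy⟩ : ∃ y, y = w / N := ⟨_, rfl⟩
  obtain ⟨p, hp⟩ : ∃ y, y = q / N := ⟨_, rfl⟩
  have hw : w = N * y := by rw [hy]; field_simp
  have hq' : q = N * p := by rw [hp]; field_simp
  have hp0 : 0 ≤ p := by rw [hp]; positivity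
  have e1 : 2 * N / t = N * (2 * r) := by rw [hr]; ring
  have e2 : 2 * N / t ^ 2 = N * (2 * r ^ 2) := by rw [hr]; field_simp
  have e3 : w ^ 2 / N = N * y ^ 2 := by rw [hw]; field_simp
  rw [e2, e3, hw, hq']
  rw [e1, hw, hq'] at hneg
  have h1 : 2 * y + p + 2 * r + 1 / 4 < 0 := by
    by_contra! hc
    nlinarith [mul_nonneg hN.le hc]
  have h2 : 0 < 2 * y ^ 2 - 2 * y - 2 * p - 2 * r ^ 2 := by
    obtain ⟨s, hs⟩ : ∃ s, s = - y - r - 1 / 8 := ⟨_, rfl⟩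
    have hy' : y = - r - 1 / 8 - s := by linarith
    have hs0 : 0 < s := by linarith
    have hps : p < 2 * s := by linarith
    subst hy'
    nlinarith [mul_pos hr0 hs0, sq_nonneg (s - 3 / 8)]
  nlinarith [mul_pos hN h2]

lemma DD_line {W : Type*} [NormedAddCommGroup W] [NormedSpace ℝ W] {F : W → ℝ} (z v : W) (s : ℝ)
    (h : DifferentiableAt ℝ F (z + s • v)) :
    HasDerivAt (fun s : ℝ => F (z + s • v)) (DD v F (z + s • v)) s := by
  have h1 : HasDerivAt (fun s : ℝ => z + s • v) v s := by
    simpa using ((hasDerivAt_id s).smul_const v).const_add z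
  exact h.hasFDerivAt.comp_hasDerivAt s h1

lemma no_neg_min {n : ℕ} (hn : 1 ≤ n) {E : Type*} [NormedAddCommGroup E] [NormedSpace ℝ E]
    {T : ℝ} (b : Fin n → E) {u : ℝ × E → ℝ}
    (hu : ContDiffOn ℝ (⊤ : ℕ∞) u (Ioo 0 T ×ˢ univ))
    (hpde : ∀ z ∈ Ioo 0 T ×ˢ (univ : Set E), DD ((1 : ℝ), (0 : E)) u z
      = ∑ i, DD ((0 : ℝ), b i) (DD ((0 : ℝ), b i) u) z + ∑ i, (DD ((0 : ℝ), b i) u z) ^ 2 - u z)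
    {ε t₀ : ℝ} {x₀ : E} (hε : 0 < ε) (h1 : ε < t₀) (h2 : t₀ < T)
    (hminx : ∀ x, PP (fun i => ((0 : ℝ), b i)) u (t₀, x₀) ≤ PP (fun i => ((0 : ℝ), b i)) u (t₀, x))
    (hmint : ∀ s, ε ≤ s → s ≤ t₀ →
      PP (fun i => ((0 : ℝ), b i)) u (t₀, x₀) + 2 * n / t₀
        ≤ PP (fun i => ((0 : ℝ), b i)) u (s, x₀) + 2 * n / s) :
    0 ≤ PP (fun i => ((0 : ℝ), b i)) u (t₀, x₀) + 2 * n / t₀ + n / 4 := by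
  have hU : IsOpen (Ioo 0 T ×ˢ (univ : Set E)) := isOpen_Ioo.prod isOpen_univ
  have hN : (0 : ℝ) < n := by exact_mod_cast hn
  have ht0 : 0 < t₀ := hε.trans h1
  set bb : Fin n → ℝ × E := fun i => ((0 : ℝ), b i) with hbb
  have hz : (t₀, x₀) ∈ Ioo 0 T ×ˢ (univ : Set E) := ⟨⟨ht0, h2⟩, trivial⟩
  have hPs := PP_smooth hU bb hu
  have hline : ∀ i (s : ℝ), (t₀, x₀) + s • bb i = (t₀, x₀ + s • b i) := by
    intro i s; simp [hbb]
  have hlU : ∀ i (s : ℝ), (t₀, x₀) + s • bb i ∈ Ioo 0 T ×ˢ (univ : Set E) := by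
    intro i s; rw [hline]; exact ⟨⟨ht0, h2⟩, trivial⟩
  have hsp : ∀ i, DD (bb i) (PP bb u) (t₀, x₀) = 0
      ∧ 0 ≤ DD (bb i) (DD (bb i) (PP bb u)) (t₀, x₀) := by
    intro i
    have := snd_deriv_test (g := fun s : ℝ => PP bb u ((t₀, x₀) + s • bb i))
      (g' := fun s : ℝ => DD (bb i) (PP bb u) ((t₀, x₀) + s • bb i))
      (d := DD (bb i) (DD (bb i) (PP bb u)) ((t₀, x₀) + (0 : ℝ) • bb i))
      (fun s => DD_line _ _ _ (smooth_diffAt hU hPs (hlU i s)))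
      (DD_line _ _ _ (smooth_diffAt hU (DD_smooth hU hPs _) (hlU i 0)))
      (fun s => by rw [hline, hline]; simpa using hminx _)
    simpa using this
  have htime : DD ((1 : ℝ), (0 : E)) (PP bb u) (t₀, x₀) - 2 * n / t₀ ^ 2 ≤ 0 := by
    have hl : HasDerivAt (fun s : ℝ => PP bb u (s, x₀))
        (DD ((1 : ℝ), (0 : E)) (PP bb u) (t₀, x₀)) t₀ := by
      have := (smooth_diffAt hU hPs hz).hasFDerivAt.comp_hasDerivAt t₀
        ((hasDerivAt_id t₀).prodMk (hasDerivAt_const t₀ x₀))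
      exact this
    have hd : HasDerivAt (fun s : ℝ => PP bb u (s, x₀) + 2 * n / s)
        (DD ((1 : ℝ), (0 : E)) (PP bb u) (t₀, x₀) - 2 * n / t₀ ^ 2) t₀ := by
      have := hl.add ((hasDerivAt_inv ht0.ne').const_mul (2 * (n : ℝ)))
      refine this.congr_deriv ?_
      ring
    exact left_deriv_nonpos h1 hd hmint
  have hev := evolution hU bb ((1 : ℝ), (0 : E)) hu hpde hz
  by_contra! hneg
  set w := ∑ i, DD (bb i) (DD (bb i) u) (t₀, x₀) with hw
  set q := ∑ i, (DD (bb i) u (t₀, x₀)) ^ 2 with hq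
  have hPwq : PP bb u (t₀, x₀) = 2 * w + q := rfl
  have hq0 : 0 ≤ q := Finset.sum_nonneg fun i _ => sq_nonneg _
  have hfin := final_alg (N := n) hN ht0 hq0 (by rw [← hPwq]; exact hneg)
  have hCS : w ^ 2 / n ≤ ∑ i, ∑ j, (DD (bb i) (DD (bb j) u) (t₀, x₀)) ^ 2 := by
    rw [div_le_iff₀ hN, mul_comm]
    have c1 := sq_sum_le_card_mul_sum_sq (s := (Finset.univ : Finset (Fin n)))
      (f := fun i => DD (bb i) (DD (bb i) u) (t₀, x₀))
    simp only [Finset.card_univ, Fintype.card_fin] at c1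
    refine c1.trans (mul_le_mul_of_nonneg_left ?_ hN.le)
    refine Finset.sum_le_sum fun i _ => ?_
    exact Finset.single_le_sum (f := fun j => (DD (bb i) (DD (bb j) u) (t₀, x₀)) ^ 2)
      (fun j _ => sq_nonneg _) (Finset.mem_univ i)
  have hz1 : ∑ i, DD (bb i) u (t₀, x₀) * DD (bb i) (PP bb u) (t₀, x₀) = 0 :=
    Finset.sum_eq_zero fun i _ => by rw [(hsp i).1, mul_zero]
  have hz2 : 0 ≤ ∑ i, DD (bb i) (DD (bb i) (PP bb u)) (t₀, x₀) :=
    Finset.sum_nonneg fun i _ => (hsp i).2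
  rw [hz1] at hev
  linarith

lemma sp_smooth {E : Type*} [NormedAddCommGroup E] [NormedSpace ℝ E] {T : ℝ} (hT : 0 < T)
    {g : ℝ → E → ℝ}
    (hg : ContDiffOn ℝ (⊤ : ℕ∞) (Function.uncurry g) (Icc (0 : ℝ) T ×ˢ (univ : Set E))) (v : E) :
    ContDiffOn ℝ (⊤ : ℕ∞) (Function.uncurry fun t y => fderiv ℝ (g t) y v)
      (Icc (0 : ℝ) T ×ˢ (univ : Set E)) := by
  have hS : UniqueDiffOn ℝ (Icc (0 : ℝ) T ×ˢ (univ : Set E)) :=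
    (uniqueDiffOn_Icc hT).prod uniqueDiffOn_univ
  have h := (hg.fderivWithin hS (m := (⊤ : ℕ∞)) (by simp)).clm_apply
    (contDiffOn_const (c := ((0 : ℝ), v)))
  refine h.congr ?_
  rintro ⟨t, y⟩ hz
  have h1 := ((hg.differentiableOn (by simp)) (t, y) hz).hasFDerivWithinAt
  have h2 : HasFDerivAt (fun y : E => (t, y)) (ContinuousLinearMap.inr ℝ ℝ E) y :=
    hasFDerivAt_prodMk_right t y
  have h3 := h1.comp_hasFDerivAt (f := fun y : E => (t, y)) y h2
    (Filter.Eventually.of_forall fun y' => ⟨hz.1, trivial⟩)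
  have h4 : HasFDerivAt (g t) _ y := h3
  simp only [Function.uncurry]
  rw [h4.fderiv]
  simp

lemma sp_eq_DD {E : Type*} [NormedAddCommGroup E] [NormedSpace ℝ E]
    {g : ℝ → E → ℝ} {t : ℝ} {y : E}
    (hg : DifferentiableAt ℝ (Function.uncurry g) (t, y)) (v : E) :
    fderiv ℝ (g t) y v = DD ((0 : ℝ), v) (Function.uncurry g) (t, y) := by
  have h2 : HasFDerivAt (fun y : E => (t, y)) (ContinuousLinearMap.inr ℝ ℝ E) y :=
    hasFDerivAt_prodMk_right t y
  have h4 : HasFDerivAt (g t) _ y := hg.hasFDerivAt.comp (f := fun y : E => (t, y)) y h2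
  rw [h4.fderiv]
  simp [DD]

lemma time_eq_DD {E : Type*} [NormedAddCommGroup E] [NormedSpace ℝ E]
    {g : ℝ → E → ℝ} {t : ℝ} {y : E}
    (hg : DifferentiableAt ℝ (Function.uncurry g) (t, y)) :
    deriv (fun s => g s y) t = DD ((1 : ℝ), (0 : E)) (Function.uncurry g) (t, y) := by
  have := hg.hasFDerivAt.comp_hasDerivAt t
    ((hasDerivAt_id t).prodMk (hasDerivAt_const t y))
  have h4 : HasDerivAt (fun s => g s y) _ t := this
  rw [h4.deriv]
  rfl

lemma grad_sq (n : ℕ) (g : EuclideanSpace ℝ (Fin n) → ℝ) (x : EuclideanSpace ℝ (Fin n)) :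
    ‖gradient g x‖ ^ 2 = ∑ i, (fderiv ℝ g x (e n i)) ^ 2 := by
  rw [EuclideanSpace.norm_sq_eq]
  refine Finset.sum_congr rfl fun i _ => ?_
  have h1 : fderiv ℝ g x (e n i) = inner ℝ (gradient g x) (e n i) := by
    simp [gradient]
  rw [h1, e, EuclideanSpace.inner_single_right]
  simp

lemma exists_rep (n : ℕ) : ∃ K : Set (EuclideanSpace ℝ (Fin n)), IsCompact K ∧
    ∀ x, ∃ k : Fin n → ℤ, x + (WithLp.equiv 2 (Fin n → ℝ)).symm (fun i => (k i : ℝ)) ∈ K := by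
  refine ⟨WithLp.toLp 2 '' (Set.pi univ fun _ : Fin n => Icc (0 : ℝ) 1),
    (isCompact_univ_pi fun _ => isCompact_Icc).image (PiLp.continuous_toLp 2 _), ?_⟩
  intro x
  refine ⟨fun i => - ⌊x i⌋, fun i => Int.fract (x i), ?_, ?_⟩
  · intro i _
    exact ⟨Int.fract_nonneg _, (Int.fract_lt_one _).le⟩
  · ext i
    simp [Int.fract, sub_eq_add_neg]

/-- the Harnack quantity on the torus -/
def P0 (n : ℕ) (u : ℝ → EuclideanSpace ℝ (Fin n) → ℝ) (t : ℝ)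
    (x : EuclideanSpace ℝ (Fin n)) : ℝ :=
  2 * slap n u t x + ‖sgrad n u t x‖ ^ 2

lemma P0_per {n : ℕ} {u : ℝ → EuclideanSpace ℝ (Fin n) → ℝ} {t : ℝ}
    {k : EuclideanSpace ℝ (Fin n)} (h : ∀ x, u t (x + k) = u t x) (x) :
    P0 n u t (x + k) = P0 n u t x := by
  have h1 : ∀ (g : EuclideanSpace ℝ (Fin n) → ℝ), (∀ x, g (x + k) = g x) →
      ∀ x v, fderiv ℝ g (x + k) v = fderiv ℝ g x v := by
    intro g hg x v
    rw [← fderiv_comp_add_right]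
    congr 2
    funext y
    exact hg y
  unfold P0 slap shess sgrad
  rw [grad_sq, grad_sq]
  congr 1
  · congr 1
    refine Finset.sum_congr rfl fun i _ => ?_
    exact h1 _ (fun y => h1 _ h y _) x _
  · exact Finset.sum_congr rfl fun i _ => by rw [h1 _ h]

lemma P0_cont {n : ℕ} {T : ℝ} (hT : 0 < T) {u : ℝ → EuclideanSpace ℝ (Fin n) → ℝ}
    (hu : ContDiffOn ℝ (⊤ : ℕ∞) (Function.uncurry u)
      (Icc (0 : ℝ) T ×ˢ (univ : Set (EuclideanSpace ℝ (Fin n))))) :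
    ContinuousOn (fun z : ℝ × EuclideanSpace ℝ (Fin n) => P0 n u z.1 z.2)
      (Icc (0 : ℝ) T ×ˢ (univ : Set (EuclideanSpace ℝ (Fin n)))) := by
  unfold P0 slap shess sgrad
  simp only [grad_sq]
  refine ContinuousOn.add (continuousOn_const.mul (continuousOn_finsetSum _ fun i _ => ?_))
    (continuousOn_finsetSum _ fun i _ => ContinuousOn.pow ?_ 2)
  · exact (sp_smooth hT (sp_smooth hT hu (e n i)) (e n i)).continuousOn
  · exact (sp_smooth hT hu (e n i)).continuousOn

lemma sp2_eq_DD {n : ℕ} {E : Type*} [NormedAddCommGroup E] [NormedSpace ℝ E] {T : ℝ}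
    {g : ℝ → E → ℝ}
    (hg : ContDiffOn ℝ (⊤ : ℕ∞) (Function.uncurry g) (Ioo (0 : ℝ) T ×ˢ (univ : Set E)))
    {t : ℝ} (ht : t ∈ Ioo 0 T) (x v w : E) :
    fderiv ℝ (fun y => fderiv ℝ (g t) y v) x w
      = DD ((0 : ℝ), w) (DD ((0 : ℝ), v) (Function.uncurry g)) (t, x) := by
  have hU : IsOpen (Ioo 0 T ×ˢ (univ : Set E)) := isOpen_Ioo.prod isOpen_univ
  have h1 : (fun y => fderiv ℝ (g t) y v)
      = (fun t y => DD ((0 : ℝ), v) (Function.uncurry g) (t, y)) t := by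
    funext y
    exact sp_eq_DD (smooth_diffAt hU hg ⟨ht, trivial⟩) v
  rw [h1, sp_eq_DD (g := fun t y => DD ((0 : ℝ), v) (Function.uncurry g) (t, y))]
  · rfl
  · exact smooth_diffAt hU (DD_smooth hU hg _) ⟨ht, trivial⟩

lemma log_pde {W : Type*} [NormedAddCommGroup W] [NormedSpace ℝ W] {n : ℕ} {U : Set W}
    (hU : IsOpen U) (b : Fin n → W) (τ : W) {F : W → ℝ}
    (hF : ContDiffOn ℝ (⊤ : ℕ∞) F U) (hpos : ∀ z ∈ U, 0 < F z)
    (hpde : ∀ z ∈ U, DD τ F z = ∑ i, DD (b i) (DD (b i) F) z - F z * Real.log (F z))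
    {z : W} (hz : z ∈ U) :
    DD τ (fun z => Real.log (F z)) z = ∑ i, DD (b i) (DD (b i) (fun z => Real.log (F z))) z
      + ∑ i, (DD (b i) (fun z => Real.log (F z)) z) ^ 2 - Real.log (F z) := by
  have h1 : ∀ v, ∀ z ∈ U, DD v (fun z => Real.log (F z)) z = (F z)⁻¹ * DD v F z := by
    intro v z hz
    have := (smooth_diffAt hU hF hz).hasFDerivAt.log (hpos z hz).ne'
    unfold DD
    rw [this.fderiv]
    simp
  have h2 : ∀ v, ∀ z ∈ U, DD v (DD v (fun z => Real.log (F z))) z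
      = (F z)⁻¹ * DD v (DD v F) z - ((F z)⁻¹ * DD v F z) ^ 2 := by
    intro v z hz
    rw [DD_congr hU (h1 v) v hz]
    have a1 := (hasDerivAt_inv (hpos z hz).ne').comp_hasFDerivAt z
      (smooth_diffAt hU hF hz).hasFDerivAt
    have := a1.mul (smooth_diffAt hU (DD_smooth hU hF v) hz).hasFDerivAt
    refine (congrArg (fun L => L v) this.fderiv).trans ?_
    simp [DD]
    ring
  rw [h1 _ z hz, hpde z hz, ← Finset.sum_add_distrib]
  have : ∀ i, DD (b i) (DD (b i) (fun z => Real.log (F z))) z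
      + (DD (b i) (fun z => Real.log (F z)) z) ^ 2 = (F z)⁻¹ * DD (b i) (DD (b i) F) z := by
    intro i
    rw [h1 _ z hz, h2 _ z hz]; ring
  simp only [this, ← Finset.mul_sum]
  have := (hpos z hz).ne'
  field_simp

/-- Corollary 2.1 (differential Harnack estimate for `∂_t f = Δf − f log f`)
on the flat torus `ℝⁿ/ℤⁿ`. -/
theorem harnack_nonlinear_heat_torus (n : ℕ) (hn : 1 ≤ n) (T : ℝ) (hT : 0 < T)
    (f : ℝ → EuclideanSpace ℝ (Fin n) → ℝ)
    (hf : ContDiffOn ℝ (⊤ : ℕ∞) (Function.uncurry f)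
      (Icc (0 : ℝ) T ×ˢ (univ : Set (EuclideanSpace ℝ (Fin n)))))
    (hpos : ∀ t ∈ Icc (0 : ℝ) T, ∀ x, 0 < f t x)
    (hper : ∀ t ∈ Icc (0 : ℝ) T, ∀ x, ∀ k : Fin n → ℤ,
      f t (x + (WithLp.equiv 2 (Fin n → ℝ)).symm fun i => (k i : ℝ)) = f t x)
    (hpde : ∀ t ∈ Icc (0 : ℝ) T, ∀ x,
      tderiv n f t x = slap n f t x - f t x * Real.log (f t x)) :
    ∀ t ∈ Ioc (0 : ℝ) T, ∀ x,
      0 ≤ 2 * slap n (fun s y => Real.log (f s y)) t x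
          + ‖sgrad n (fun s y => Real.log (f s y)) t x‖ ^ 2
          + 2 * n / t + n / 4 := by
  set u : ℝ → EuclideanSpace ℝ (Fin n) → ℝ := fun s y => Real.log (f s y) with hudef
  have huS : ContDiffOn ℝ (⊤ : ℕ∞) (Function.uncurry u)
      (Icc (0 : ℝ) T ×ˢ (univ : Set (EuclideanSpace ℝ (Fin n)))) := by
    refine ContDiffOn.log (f := Function.uncurry f) hf ?_
    rintro ⟨t, x⟩ hz
    exact (hpos t hz.1 x).ne'
  have hsub : Ioo (0 : ℝ) T ×ˢ (univ : Set (EuclideanSpace ℝ (Fin n)))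
      ⊆ Icc (0 : ℝ) T ×ˢ (univ : Set (EuclideanSpace ℝ (Fin n))) :=
    Set.prod_mono Ioo_subset_Icc_self le_rfl
  have hU : IsOpen (Ioo (0 : ℝ) T ×ˢ (univ : Set (EuclideanSpace ℝ (Fin n)))) :=
    isOpen_Ioo.prod isOpen_univ
  have hfU := hf.mono hsub
  have huU := huS.mono hsub
  have hpdeU : ∀ z ∈ Ioo 0 T ×ˢ (univ : Set (EuclideanSpace ℝ (Fin n))),
      DD ((1 : ℝ), (0 : EuclideanSpace ℝ (Fin n))) (Function.uncurry u) z
      = ∑ i, DD ((0 : ℝ), e n i) (DD ((0 : ℝ), e n i) (Function.uncurry u)) z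
        + ∑ i, (DD ((0 : ℝ), e n i) (Function.uncurry u) z) ^ 2 - Function.uncurry u z := by
    intro z hz
    refine log_pde hU (fun i => ((0 : ℝ), e n i)) _ hfU
      (fun z hz => hpos z.1 (Ioo_subset_Icc_self hz.1) z.2) ?_ hz
    rintro ⟨t, x⟩ hz
    have h1 := hpde t (Ioo_subset_Icc_self hz.1) x
    rw [tderiv, time_eq_DD (smooth_diffAt hU hfU hz), slap] at h1
    rw [h1]
    simp only [shess, sp2_eq_DD (n := n) hfU hz.1]
    rfl
  have hPP : ∀ t ∈ Ioo 0 T, ∀ x, P0 n u t x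
      = PP (fun i => ((0 : ℝ), e n i)) (Function.uncurry u) (t, x) := by
    intro t ht x
    simp only [P0, slap, shess, sgrad, grad_sq, PP, sp2_eq_DD (n := n) huU ht]
    simp only [sp_eq_DD (smooth_diffAt hU huU (⟨ht, trivial⟩ : (t, x) ∈ Ioo (0 : ℝ) T ×ˢ univ))]
  have hPc := P0_cont hT huS
  have hPper : ∀ t ∈ Icc 0 T, ∀ x, ∀ k : Fin n → ℤ,
      P0 n u t (x + (WithLp.equiv 2 (Fin n → ℝ)).symm fun i => (k i : ℝ)) = P0 n u t x := by
    intro t ht x k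
    refine P0_per (fun x => ?_) x
    simp only [hudef]
    rw [hper t ht x k]
  have hN : (0 : ℝ) < n := by exact_mod_cast hn
  have claim : ∀ t ∈ Ioo (0 : ℝ) T, ∀ x, 0 ≤ P0 n u t x + 2 * n / t + n / 4 := by
    intro t₁ ht₁ x₁
    obtain ⟨K, hK, hrep⟩ := exists_rep n
    by_contra! hneg
    obtain ⟨M, hM⟩ := ((isCompact_Icc (a := (0 : ℝ)) (b := T)).prod hK).exists_bound_of_continuousOn
      (hPc.mono (Set.prod_mono le_rfl (subset_univ _)))
    obtain ⟨k₁, hk₁⟩ := hrep x₁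
    obtain ⟨ε, hε0, hε1, hε2⟩ : ∃ ε, 0 < ε ∧ ε < t₁ ∧ |M| ≤ 2 * n / ε := by
      refine ⟨min (t₁ / 2) (2 * n / (|M| + 1)), ?_, ?_, ?_⟩
      · have := ht₁.1
        positivity
      · exact (min_le_left _ _).trans_lt (by linarith [ht₁.1])
      · have h0 : 0 < min (t₁ / 2) (2 * n / (|M| + 1)) := by
          have := ht₁.1
          positivity
        rw [le_div_iff₀ h0]
        calc |M| * min (t₁ / 2) (2 * n / (|M| + 1))
            ≤ (|M| + 1) * (2 * n / (|M| + 1)) := by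
              gcongr
              · linarith
              · exact min_le_right _ _
          _ = 2 * n := by field_simp
    have hsubK : Icc ε t₁ ×ˢ K ⊆ Icc 0 T ×ˢ (univ : Set (EuclideanSpace ℝ (Fin n))) :=
      Set.prod_mono (Icc_subset_Icc hε0.le ht₁.2.le) (subset_univ _)
    have hcont : ContinuousOn (fun z : ℝ × EuclideanSpace ℝ (Fin n) =>
        P0 n u z.1 z.2 + 2 * n / z.1) (Icc ε t₁ ×ˢ K) := by
      refine (hPc.mono hsubK).add (continuousOn_const.div continuous_fst.continuousOn ?_)
      rintro ⟨s, y⟩ hz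
      exact (hε0.trans_le hz.1.1).ne'
    obtain ⟨⟨t₀, x₀⟩, hz₀, hmin⟩ := ((isCompact_Icc (a := ε) (b := t₁)).prod hK).exists_isMinOn
      ⟨(t₁, _), ⟨⟨hε1.le, le_rfl⟩, hk₁⟩⟩ hcont
    have hIcc : ∀ s ∈ Icc ε t₁, s ∈ Icc 0 T := fun s hs =>
      ⟨hε0.le.trans hs.1, hs.2.trans ht₁.2.le⟩
    have hIoo : ∀ s ∈ Icc ε t₁, s ∈ Ioo 0 T := fun s hs =>
      ⟨hε0.trans_le hs.1, hs.2.trans_lt ht₁.2⟩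
    have hall : ∀ s ∈ Icc ε t₁, ∀ x, P0 n u t₀ x₀ + 2 * n / t₀ ≤ P0 n u s x + 2 * n / s := by
      intro s hs x
      obtain ⟨k, hk⟩ := hrep x
      have := isMinOn_iff.1 hmin (s, _) ⟨hs, hk⟩
      simp only at this
      rwa [hPper s (hIcc s hs)] at this
    have hlt := hall t₁ ⟨hε1.le, le_rfl⟩ x₁
    have ht₀ε : ε < t₀ := by
      refine lt_of_le_of_ne hz₀.1.1 fun heq => ?_
      have h1 := hM (t₀, x₀) ⟨hIcc t₀ hz₀.1, hz₀.2⟩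
      rw [Real.norm_eq_abs] at h1
      simp only at h1
      have h2 := (abs_le.1 (h1.trans (le_abs_self M))).1
      rw [heq] at hε2
      linarith
    have hfinal := no_neg_min hn (e n) huU hpdeU hε0 ht₀ε (hz₀.1.2.trans_lt ht₁.2) (x₀ := x₀)
      (fun x => by
        rw [← hPP t₀ (hIoo t₀ hz₀.1), ← hPP t₀ (hIoo t₀ hz₀.1)]
        linarith [hall t₀ hz₀.1 x])
      (fun s hs1 hs2 => by
        have hs : s ∈ Icc ε t₁ := ⟨hs1, hs2.trans hz₀.1.2⟩
        rw [← hPP t₀ (hIoo t₀ hz₀.1), ← hPP s (hIoo s hs)]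
        exact hall s hs x₀)
    rw [← hPP t₀ (hIoo t₀ hz₀.1)] at hfinal
    linarith
  intro t ht x
  change 0 ≤ P0 n u t x + 2 * n / t + n / 4
  rcases ht.2.lt_or_eq with hlt | rfl
  · exact claim t ⟨ht.1, hlt⟩ x
  · have hc : ContinuousWithinAt (fun s => P0 n u s x + 2 * n / s + n / 4) (Ioo 0 t) t := by
      have h1 : ContinuousWithinAt (fun s => P0 n u s x) (Ioo 0 t) t := by
        have h2 := hPc (t, x) ⟨⟨ht.1.le, le_rfl⟩, trivial⟩
        exact h2.comp (f := fun s : ℝ => (s, x)) (t := Icc 0 t ×ˢ univ)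
          (Continuous.continuousWithinAt (by fun_prop))
          (fun s hs => ⟨Ioo_subset_Icc_self hs, trivial⟩)
      exact (h1.add (continuousWithinAt_const.div continuousWithinAt_id ht.1.ne')).add
        continuousWithinAt_const
    have hne : (nhdsWithin t (Ioo 0 t)).NeBot := right_nhdsWithin_Ioo_neBot ht.1
    refine ge_of_tendsto hc ?_
    filter_upwards [self_mem_nhdsWithin] with s hs using claim s hs x
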